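/- Let n < ω and let α be any ordinal. Then B_n(α) ∩ Ω_n = ψ_n(α); that is, an ordinal β < Ω_n belongs to B_n(α) if and only if β < ψ_n(α). -/

import Mathlib

open Ordinal Set

/-- The Veblen hierarchy: `phi 0` is the strictly increasing enumeration of the
additively principal ordinals (nonzero ordinals closed under addition), and for `α > 0`,
`phi α` is the strictly increasing enumeration of the common fixed points of the
functions `phi δ` for `δ < α`. -/
noncomputable def phi : Ordinal → Ordinal → Ordinal
  | α => Ordinal.enumOrd {β | (α = 0 → β ≠ 0 ∧ ∀ γ < β, ∀ δ < β, γ + δ < β) ∧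
      ∀ δ, δ < α → phi δ β = β}
termination_by α => α
decreasing_by assumption

/-- `Cr 0` is the class of additively principal ordinals (nonzero ordinals `β` such that
`γ + δ < β` for all `γ, δ < β`); for `α > 0`, `Cr α = {β | ∀ δ < α, phi δ β = β}`.
`phi α` is (definitionally) the strictly increasing enumeration of `Cr α`. -/
def Cr (α : Ordinal) : Set Ordinal :=
  {β | (α = 0 → β ≠ 0 ∧ ∀ γ < β, ∀ δ < β, γ + δ < β) ∧ ∀ δ, δ < α → phi δ β = β}

/-- An ordinal is strongly critical if it is nonzero and closed under `(δ, γ) ↦ phi δ γ`. -/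
def StronglyCritical (α : Ordinal) : Prop :=
  α ≠ 0 ∧ ∀ δ < α, ∀ γ < α, phi δ γ < α

/-- `Gamma β` is the `β`-th strongly critical ordinal. -/
noncomputable def Gamma : Ordinal → Ordinal :=
  Ordinal.enumOrd {α | StronglyCritical α}

/-- An ordinal which is (the initial ordinal of) an uncountable regular cardinal. -/
def IsUncountableRegular (o : Ordinal) : Prop :=
  ∃ κ : Cardinal, Cardinal.aleph0 < κ ∧ κ.IsRegular ∧ o = κ.ord

/-- The base sets `B_n^0(α)` (they do not depend on `α`):
`B_0^0(α) = {0} ∪ {Γ_β : β ≤ θ} ∪ {Ω_m : m ≤ ω}` and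
`B_{n+1}^0(α) = {β : β < Ω_n} ∪ {Ω_m : m ≤ ω}`. -/
def Bbase (θ : Ordinal) (Ω : ℕ → Ordinal) (Ωω : Ordinal) : ℕ → Set Ordinal
  | 0 => {0} ∪ {x | ∃ β ≤ θ, x = Gamma β} ∪ {x | (∃ m : ℕ, x = Ω m) ∨ x = Ωω}
  | n + 1 => {β | β < Ω n} ∪ {x | (∃ m : ℕ, x = Ω m) ∨ x = Ωω}

/-- One closure step, producing `B_n^{k+1}(α)` from `S = B_n^k(α)`, where the function `f`
plays the role of `ψ`:
`S ∪ {δ + δ' : δ, δ' ∈ S} ∪ {phi δ δ' : δ, δ' ∈ S} ∪ {f m δ : m < ω, δ ∈ S, δ < α}`. -/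
def Bstep (f : ℕ → Ordinal → Ordinal) (α : Ordinal) (S : Set Ordinal) : Set Ordinal :=
  S ∪ {x | ∃ δ ∈ S, ∃ δ' ∈ S, x = δ + δ'}
    ∪ {x | ∃ δ ∈ S, ∃ δ' ∈ S, x = phi δ δ'}
    ∪ {x | ∃ m : ℕ, ∃ δ ∈ S, δ < α ∧ x = f m δ}

/-- The sets `B_n^k(α)`, where the function `f` plays the role of `ψ`. -/
def Biter (θ : Ordinal) (Ω : ℕ → Ordinal) (Ωω : Ordinal)
    (f : ℕ → Ordinal → Ordinal) (α : Ordinal) (n : ℕ) : ℕ → Set Ordinal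
  | 0 => Bbase θ Ω Ωω n
  | k + 1 => Bstep f α (Biter θ Ω Ωω f α n k)

/-- `psi θ Ω Ωω n α` is the least ordinal not in `B_n(α) = ⋃ k, B_n^k(α)`.  (The values of
`ψ` are only ever used at arguments `δ < α`, so the guard `if δ < α` does not change the
sets `B_n^k(α)`; it only serves to make the recursion on `α` well-founded.) -/
noncomputable def psi (θ : Ordinal) (Ω : ℕ → Ordinal) (Ωω : Ordinal) : ℕ → Ordinal → Ordinal
  | n, α => sInf {β | β ∉ ⋃ k,
      Biter θ Ω Ωω (fun m δ => if _ : δ < α then psi θ Ω Ωω m δ else 0) α n k}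
termination_by n α => α
decreasing_by assumption

/-- The set `B_n(α) = ⋃ k, B_n^k(α)`. -/
noncomputable def Bset (θ : Ordinal) (Ω : ℕ → Ordinal) (Ωω : Ordinal)
    (n : ℕ) (α : Ordinal) : Set Ordinal :=
  ⋃ k, Biter θ Ω Ωω (fun m δ => if _ : δ < α then psi θ Ω Ωω m δ else 0) α n k

universe u

theorem phi_eq_veblen (α : Ordinal.{u}) : phi α = veblen α := by
  induction α using WellFoundedLT.induction with
  | ind α ih =>
    rw [phi, ← enumOrd_range (veblen_right_strictMono α)]
    congr 1
    ext β
    rw [Set.mem_ofPred_eq]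
    rcases eq_or_ne α 0 with rfl | hα
    · have := isPrincipal_add_iff_zero_or_omega0_opow (o := β)
      have hne (a : Ordinal.{u}) : ω ^ a ≠ 0 := (opow_pos a omega0_pos).ne'
      simp only [veblen_zero, not_lt_zero, IsEmpty.forall_iff, implies_true, and_true,
        forall_const]
      constructor
      · rintro ⟨h0, h⟩
        exact (this.1 fun γ δ hγ hδ ↦ h γ hγ δ hδ).resolve_left h0
      · intro h
        have hp := this.2 (.inr h)
        obtain ⟨a, rfl⟩ := h
        exact ⟨hne a, fun γ hγ δ hδ ↦ hp hγ hδ⟩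
    · rw [mem_range_veblen hα]
      constructor
      · intro h b hb
        rw [← ih b hb]
        exact h.2 b hb
      · intro h
        refine ⟨fun h0 ↦ absurd h0 hα, fun b hb ↦ ?_⟩
        rw [ih b hb]
        exact h b hb

theorem stronglyCritical_gamma (a : Ordinal.{u}) : StronglyCritical (Γ_ a) := by
  refine ⟨gamma_ne_zero, fun δ hδ γ hγ ↦ ?_⟩
  rw [phi_eq_veblen, ← veblen_gamma_zero a, veblen_lt_veblen_iff]
  exact .inr (.inl ⟨hδ, by rwa [veblen_gamma_zero]⟩)

theorem not_bddAbove_stronglyCritical : ¬ BddAbove {a : Ordinal.{u} | StronglyCritical a} := by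
  rintro ⟨b, hb⟩
  have h := hb (stronglyCritical_gamma (Order.succ b))
  exact (Order.lt_succ b).not_ge (strictMono_gamma.le_apply.trans h)

theorem Gamma_strictMono : StrictMono Gamma.{u} :=
  enumOrd_strictMono not_bddAbove_stronglyCritical

/-- Every ordinal is either zero, a sum of smaller ordinals, a value of the Veblen function at
smaller ordinals, or of the form `Γ_ a`. -/
theorem mem_range_gamma_of_add_ne_of_veblen_ne {x : Ordinal.{u}} (h0 : x ≠ 0)
    (hadd : ∀ a < x, ∀ b < x, a + b ≠ x) (hveb : ∀ a < x, ∀ b < x, veblen a b ≠ x) :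
    x ∈ Set.range Γ_ := by
  obtain ⟨y, rfl⟩ := (isPrincipal_add_iff_zero_or_omega0_opow.1
    (isPrincipal_add_iff_add_lt_ne_self.2 hadd)).resolve_left h0
  have hy : y ≤ ω ^ y := right_le_opow y one_lt_omega0
  have h₁ : ω ^ y ≤ invVeblen₁ y := not_lt.1 fun h ↦
    hveb _ h _ (invVeblen₂_lt y) (veblen_invVeblen₁_invVeblen₂ y)
  have h₂ : invVeblen₁ y = y := (invVeblen₁_le y).antisymm (hy.trans h₁)
  have h₃ : ω ^ y = y := (h₁.trans (invVeblen₁_le y)).antisymm hy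
  simp only [h₃] at h0 ⊢
  exact (invVeblen₁_eq_iff.1 h₂).resolve_left h0

/-- A set closed under `+` and `phi` contains every ordinal
below a bound as soon as it contains `0` and the strongly critical ordinals below that bound. -/
theorem mem_of_stronglyCritical_mem {S : Set Ordinal.{u}} {o : Ordinal.{u}} (h0 : 0 ∈ S)
    (hadd : ∀ a ∈ S, ∀ b ∈ S, a + b ∈ S) (hphi : ∀ a ∈ S, ∀ b ∈ S, phi a b ∈ S)
    (hsc : ∀ a < o, StronglyCritical a → a ∈ S) {x : Ordinal.{u}} (hx : x < o) : x ∈ S := by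
  induction x using WellFoundedLT.induction with
  | ind x ih =>
    by_contra hxS
    have ih' : ∀ a < x, a ∈ S := fun a ha ↦ ih a ha (ha.trans hx)
    obtain ⟨a, rfl⟩ := mem_range_gamma_of_add_ne_of_veblen_ne (x := x)
      (by rintro rfl; exact hxS h0)
      (fun a ha b hb h ↦ hxS (h ▸ hadd a (ih' a ha) b (ih' b hb)))
      (fun a ha b hb h ↦ hxS (h ▸ phi_eq_veblen a ▸ hphi a (ih' a ha) b (ih' b hb)))
    exact hxS (hsc _ hx (stronglyCritical_gamma a))

section Closure

variable {θ Ωω : Ordinal.{u}} {Ω : ℕ → Ordinal.{u}} {n : ℕ} {α : Ordinal.{u}}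

theorem monotone_Biter (θ : Ordinal.{u}) (Ω : ℕ → Ordinal.{u}) (Ωω : Ordinal.{u})
    (f : ℕ → Ordinal.{u} → Ordinal.{u}) (α : Ordinal.{u}) (n : ℕ) :
    Monotone (Biter θ Ω Ωω f α n) :=
  monotone_nat_of_le_succ fun _ _ hx ↦ .inl (.inl (.inl hx))

theorem Bbase_subset_Bset : Bbase θ Ω Ωω n ⊆ Bset θ Ω Ωω n α :=
  fun _ hx ↦ Set.mem_iUnion.2 ⟨0, hx⟩

theorem exists_mem_Biter_of_mem_Bset {f : ℕ → Ordinal.{u} → Ordinal.{u}} {a b : Ordinal.{u}}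
    (ha : a ∈ ⋃ k, Biter θ Ω Ωω f α n k) (hb : b ∈ ⋃ k, Biter θ Ω Ωω f α n k) :
    ∃ k, a ∈ Biter θ Ω Ωω f α n k ∧ b ∈ Biter θ Ω Ωω f α n k := by
  obtain ⟨k, hk⟩ := Set.mem_iUnion.1 ha
  obtain ⟨l, hl⟩ := Set.mem_iUnion.1 hb
  exact ⟨max k l, monotone_Biter _ _ _ _ _ _ (le_max_left k l) hk,
    monotone_Biter _ _ _ _ _ _ (le_max_right k l) hl⟩

theorem add_mem_Bset {a b : Ordinal.{u}} (ha : a ∈ Bset θ Ω Ωω n α)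
    (hb : b ∈ Bset θ Ω Ωω n α) : a + b ∈ Bset θ Ω Ωω n α := by
  obtain ⟨k, hak, hbk⟩ := exists_mem_Biter_of_mem_Bset ha hb
  exact Set.mem_iUnion.2 ⟨k + 1, .inl (.inl (.inr ⟨a, hak, b, hbk, rfl⟩))⟩

theorem phi_mem_Bset {a b : Ordinal.{u}} (ha : a ∈ Bset θ Ω Ωω n α)
    (hb : b ∈ Bset θ Ω Ωω n α) : phi a b ∈ Bset θ Ω Ωω n α := by
  obtain ⟨k, hak, hbk⟩ := exists_mem_Biter_of_mem_Bset ha hb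
  exact Set.mem_iUnion.2 ⟨k + 1, .inl (.inr ⟨a, hak, b, hbk, rfl⟩)⟩

theorem psi_mem_Bset {δ : Ordinal.{u}} (m : ℕ) (hδ : δ ∈ Bset θ Ω Ωω n α) (hδα : δ < α) :
    psi θ Ω Ωω m δ ∈ Bset θ Ω Ωω n α := by
  obtain ⟨k, hk⟩ := Set.mem_iUnion.1 hδ
  exact Set.mem_iUnion.2 ⟨k + 1, .inr ⟨m, δ, hk, hδα, by simp [hδα]⟩⟩

theorem Bset_induction {P : Ordinal.{u} → Prop} (base : ∀ x ∈ Bbase θ Ω Ωω n, P x)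
    (add : ∀ a b, P a → P b → P (a + b)) (phi : ∀ a b, P a → P b → P (phi a b))
    (psi : ∀ m, ∀ δ < α, P δ → P (psi θ Ω Ωω m δ)) {x : Ordinal.{u}}
    (hx : x ∈ Bset θ Ω Ωω n α) : P x := by
  obtain ⟨k, hk⟩ := Set.mem_iUnion.1 hx
  induction k generalizing x with
  | zero => exact base x hk
  | succ k ih =>
    have ih' := fun a (ha : a ∈ Biter θ Ω Ωω _ α n k) ↦ ih (Set.mem_iUnion.2 ⟨k, ha⟩) ha
    rcases hk with ((hk | ⟨a, ha, b, hb, rfl⟩) | ⟨a, ha, b, hb, rfl⟩) | ⟨m, a, ha, haα, rfl⟩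
    · exact ih' x hk
    · exact add a b (ih' a ha) (ih' b hb)
    · exact phi a b (ih' a ha) (ih' b hb)
    · simpa only [haα, dite_true] using psi m a haα (ih' a ha)

theorem Bset_mono : Monotone (Bset θ Ω Ωω n) := fun _ _ h _ hx ↦
  Bset_induction (P := (· ∈ Bset θ Ω Ωω n _)) (fun _ hx ↦ Bbase_subset_Bset hx)
    (fun _ _ ↦ add_mem_Bset) (fun _ _ ↦ phi_mem_Bset)
    (fun m _ hδ hδB ↦ psi_mem_Bset m hδB (hδ.trans_le h)) hx

theorem psi_eq_sInf (θ : Ordinal.{u}) (Ω : ℕ → Ordinal.{u}) (Ωω : Ordinal.{u}) (n : ℕ)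
    (α : Ordinal.{u}) : psi θ Ω Ωω n α = sInf (Bset θ Ω Ωω n α)ᶜ := by
  rw [psi]
  rfl

theorem mem_Bset_of_lt_psi {x : Ordinal.{u}} (hx : x < psi θ Ω Ωω n α) :
    x ∈ Bset θ Ω Ωω n α := by
  rw [psi_eq_sInf] at hx
  exact not_not.1 (notMem_of_lt_csInf' hx)

theorem psi_le_of_notMem_Bset {x : Ordinal.{u}} (hx : x ∉ Bset θ Ω Ωω n α) :
    psi θ Ω Ωω n α ≤ x :=
  not_lt.1 fun h ↦ hx (mem_Bset_of_lt_psi h)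

theorem zero_mem_Bset (hΩ : ∀ n, 0 < Ω n) : 0 ∈ Bset θ Ω Ωω n α := by
  apply Bbase_subset_Bset
  cases n with
  | zero => exact .inl (.inl rfl)
  | succ n => exact .inl (hΩ n)

theorem Omega_mem_Bset (m : ℕ) : Ω m ∈ Bset θ Ω Ωω n α := by
  apply Bbase_subset_Bset
  cases n <;> exact .inr (.inl ⟨m, rfl⟩)

open Cardinal in
theorem mk_Bset_le {c : Cardinal.{u + 1}} (hc : ℵ₀ ≤ c) (hbase : #(Bbase θ Ω Ωω n) ≤ c) :
    #(Bset θ Ω Ωω n α) ≤ c := by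
  have union {S T : Set Ordinal.{u}} (hS : #S ≤ c) (hT : #T ≤ c) : #(S ∪ T : Set _) ≤ c :=
    (mk_union_le S T).trans (add_le_of_le hc hS hT)
  have image2 {S : Set Ordinal.{u}} (hS : #S ≤ c) (f : Ordinal.{u} → Ordinal.{u} → Ordinal.{u}) :
      #(Set.image2 f S S) ≤ c := mk_image2_le.trans (mul_le_of_le hc hS hS)
  have iUnion {S : ℕ → Set Ordinal.{u}} (hS : ∀ k, #(S k) ≤ c) : #(⋃ k, S k) ≤ c := by
    have h := mk_iUnion_le_lift S
    simp only [Cardinal.lift_uzero] at h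
    refine h.trans (mul_le_of_le hc ?_ (ciSup_le' hS))
    simpa using hc
  refine iUnion fun k ↦ ?_
  induction k with
  | zero => exact hbase
  | succ k ih =>
    refine union (union (union ih ?_) ?_) ?_
    · refine (mk_le_mk_of_subset ?_).trans (image2 ih (· + ·))
      rintro _ ⟨a, ha, b, hb, rfl⟩
      exact ⟨a, ha, b, hb, rfl⟩
    · refine (mk_le_mk_of_subset ?_).trans (image2 ih phi)
      rintro _ ⟨a, ha, b, hb, rfl⟩
      exact ⟨a, ha, b, hb, rfl⟩
    · refine (mk_le_mk_of_subset ?_).trans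
        (iUnion (S := fun m ↦ (fun δ ↦ if _ : δ < α then psi θ Ω Ωω m δ else 0) '' _)
          fun m ↦ mk_image_le.trans ih)
      rintro _ ⟨m, a, ha, -, rfl⟩
      exact Set.mem_iUnion.2 ⟨m, a, ha, rfl⟩

theorem IsUncountableRegular.isSuccLimit {o : Ordinal.{u}} (h : IsUncountableRegular o) :
    Order.IsSuccLimit o := by
  obtain ⟨κ, hκ, -, rfl⟩ := h
  exact Cardinal.isSuccLimit_ord hκ.le

open Cardinal in
theorem mk_Bbase_le (hlim : Order.IsSuccLimit (Ω 0)) (hΩ : StrictMono Ω) (hθ : θ < Ω 0) (n : ℕ) :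
    ∃ o < Ω n, #(Bbase θ Ω Ωω n) ≤ max ℵ₀ (Cardinal.lift.{u + 1} o.card) := by
  have countable : #({x | (∃ m : ℕ, x = Ω m) ∨ x = Ωω} : Set Ordinal.{u}) ≤ ℵ₀ := by
    rw [le_aleph0_iff_set_countable]
    refine ((Set.countable_range Ω).union (Set.countable_singleton Ωω)).mono ?_
    rintro x (⟨m, rfl⟩ | rfl)
    exacts [.inl ⟨m, rfl⟩, .inr rfl]
  have union {c : Cardinal.{u + 1}} {S T : Set Ordinal.{u}} (hS : #S ≤ max ℵ₀ c)
      (hT : #T ≤ max ℵ₀ c) : #(S ∪ T : Set _) ≤ max ℵ₀ c :=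
    (mk_union_le S T).trans (add_le_of_le (le_max_left _ _) hS hT)
  cases n with
  | zero =>
    refine ⟨Order.succ θ, hlim.succ_lt hθ, union (union ?_ ?_) (le_max_of_le_left countable)⟩
    · exact le_max_of_le_left (by simp)
    · rw [← Cardinal.mk_Iio_ordinal]
      refine le_max_of_le_right ((mk_le_mk_of_subset ?_).trans (mk_image_le (f := Gamma)))
      rintro x ⟨β, hβ, rfl⟩
      exact ⟨β, Order.lt_succ_of_le hβ, rfl⟩
  | succ n =>
    refine ⟨Ω n, hΩ n.lt_succ_self, union (le_max_of_le_right ?_) (le_max_of_le_left countable)⟩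
    exact (Cardinal.mk_Iio_ordinal _).le

end Closure

section Collapsing

variable {θ Ωω : Ordinal.{u}} {Ω : ℕ → Ordinal.{u}}
  (hΩreg : ∀ n, IsUncountableRegular (Ω n)) (hΩ : StrictMono Ω) (hθ : θ < Ω 0)

include hΩreg hΩ hθ

open Cardinal in
theorem exists_lt_Omega_notMem_Bset (n : ℕ) (α : Ordinal.{u}) :
    ∃ x < Ω n, x ∉ Bset θ Ω Ωω n α := by
  obtain ⟨o, ho, hbase⟩ := mk_Bbase_le (Ωω := Ωω) (hΩreg 0).isSuccLimit hΩ hθ n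
  obtain ⟨κ, hκ, -, hκΩ⟩ := hΩreg n
  by_contra! h
  have hle : Cardinal.lift.{u + 1} κ ≤ max ℵ₀ (Cardinal.lift.{u + 1} o.card) := by
    rw [← card_ord κ, ← hκΩ, ← Cardinal.mk_Iio_ordinal]
    exact (mk_le_mk_of_subset h).trans (mk_Bset_le (le_max_left _ _) hbase)
  refine hle.not_gt (max_lt (aleph0_lt_lift.2 hκ) (Cardinal.lift_lt.2 ?_))
  rwa [← lt_ord, ← hκΩ]

theorem psi_lt_Omega (n : ℕ) (α : Ordinal.{u}) : psi θ Ω Ωω n α < Ω n := by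
  obtain ⟨x, hx, hxB⟩ := exists_lt_Omega_notMem_Bset (Ωω := Ωω) hΩreg hΩ hθ n α
  exact (psi_le_of_notMem_Bset hxB).trans_lt hx

theorem psi_notMem_Bset (n : ℕ) (α : Ordinal.{u}) : psi θ Ω Ωω n α ∉ Bset θ Ω Ωω n α := by
  obtain ⟨x, -, hxB⟩ := exists_lt_Omega_notMem_Bset (Ωω := Ωω) hΩreg hΩ hθ n α
  rw [psi_eq_sInf]
  exact csInf_mem (s := (Bset θ Ω Ωω n α)ᶜ) ⟨x, hxB⟩

theorem lt_psi_of_forall_le_mem {n : ℕ} {α x : Ordinal.{u}}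
    (h : ∀ y ≤ x, y ∈ Bset θ Ω Ωω n α) : x < psi θ Ω Ωω n α :=
  not_le.1 fun hle ↦ psi_notMem_Bset hΩreg hΩ hθ n α (h _ hle)

theorem psi_mem_range_gamma (n : ℕ) (α : Ordinal.{u}) : psi θ Ω Ωω n α ∈ Set.range Γ_ := by
  have hψ := psi_notMem_Bset (Ωω := Ωω) hΩreg hΩ hθ n α
  refine mem_range_gamma_of_add_ne_of_veblen_ne (fun h ↦ hψ ?_) (fun a ha b hb h ↦ hψ ?_)
    (fun a ha b hb h ↦ hψ ?_)
  · exact h ▸ zero_mem_Bset fun n ↦ (hΩreg n).isSuccLimit.bot_lt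
  · exact h ▸ add_mem_Bset (mem_Bset_of_lt_psi ha) (mem_Bset_of_lt_psi hb)
  · exact h ▸ phi_eq_veblen a ▸ phi_mem_Bset (mem_Bset_of_lt_psi ha) (mem_Bset_of_lt_psi hb)

theorem Omega_lt_psi_of_lt {m n : ℕ} (hmn : m < n) (α : Ordinal.{u}) :
    Ω m < psi θ Ω Ωω n α := by
  refine lt_psi_of_forall_le_mem hΩreg hΩ hθ fun y hy ↦ ?_
  obtain ⟨n, rfl⟩ := Nat.exists_eq_add_of_lt hmn
  rcases (hy.trans (hΩ.monotone (Nat.le_add_right m n))).eq_or_lt with rfl | hlt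
  · exact Omega_mem_Bset _
  · exact Bbase_subset_Bset (.inl hlt)

theorem Gamma_lt_psi_zero (α : Ordinal.{u}) {β : Ordinal.{u}} (hβ : β ≤ θ) :
    Gamma β < psi θ Ω Ωω 0 α := by
  refine lt_psi_of_forall_le_mem hΩreg hΩ hθ fun y hy ↦ ?_
  refine mem_of_stronglyCritical_mem (zero_mem_Bset fun n ↦ (hΩreg n).isSuccLimit.bot_lt)
    (fun a ha b hb ↦ add_mem_Bset ha hb) (fun a ha b hb ↦ phi_mem_Bset ha hb)
    (fun a ha hsc ↦ ?_) (Order.lt_succ_of_le hy)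
  obtain ⟨γ, rfl⟩ := enumOrd_surjective not_bddAbove_stronglyCritical hsc
  have hγ : γ ≤ β := Gamma_strictMono.le_iff_le.1 (Order.lt_succ_iff.1 ha)
  exact Bbase_subset_Bset (.inl (.inr ⟨γ, hγ.trans hβ, rfl⟩))

theorem lt_psi_of_mem_Bbase (hΩltω : ∀ n, Ω n < Ωω) {n : ℕ} {x : Ordinal.{u}} (α : Ordinal.{u})
    (hx : x ∈ Bbase θ Ω Ωω n) (hxΩ : x < Ω n) : x < psi θ Ω Ωω n α := by
  cases n with
  | zero =>
    rcases hx with (rfl | ⟨β, hβ, rfl⟩) | ⟨m, rfl⟩ | rfl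
    · obtain ⟨a, ha⟩ := psi_mem_range_gamma (Ωω := Ωω) hΩreg hΩ hθ 0 α
      exact ha ▸ gamma_pos
    · exact Gamma_lt_psi_zero hΩreg hΩ hθ α hβ
    · exact absurd (hΩ.lt_iff_lt.1 hxΩ) m.not_lt_zero
    · exact absurd hxΩ (hΩltω 0).not_gt
  | succ n =>
    rcases hx with hx | ⟨m, rfl⟩ | rfl
    · exact lt_trans hx (Omega_lt_psi_of_lt hΩreg hΩ hθ n.lt_succ_self α)
    · exact Omega_lt_psi_of_lt hΩreg hΩ hθ (hΩ.lt_iff_lt.1 hxΩ) α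
    · exact absurd hxΩ (hΩltω _).not_gt

theorem lt_psi_of_mem_Bset (hΩltω : ∀ n, Ω n < Ωω) {n : ℕ} {α x : Ordinal.{u}}
    (hx : x ∈ Bset θ Ω Ωω n α) (hxΩ : x < Ω n) : x < psi θ Ω Ωω n α := by
  obtain ⟨c, hc⟩ := psi_mem_range_gamma (Ωω := Ωω) hΩreg hΩ hθ n α
  suffices x ∈ Bset θ Ω Ωω n α ∧ (x < Ω n → x < psi θ Ω Ωω n α) from this.2 hxΩ
  refine Bset_induction (P := fun x ↦ x ∈ Bset θ Ω Ωω n α ∧ (x < Ω n → x < psi θ Ω Ωω n α))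
    (fun x hx ↦ ⟨Bbase_subset_Bset hx, lt_psi_of_mem_Bbase hΩreg hΩ hθ hΩltω α hx⟩)
    (fun a b ha hb ↦ ⟨add_mem_Bset ha.1 hb.1, fun h ↦ ?_⟩)
    (fun a b ha hb ↦ ⟨phi_mem_Bset ha.1 hb.1, fun h ↦ ?_⟩)
    (fun m δ hδα hδ ↦ ⟨psi_mem_Bset m hδ.1 hδα, fun h ↦ ?_⟩) hx
  · have hp : IsPrincipal (· + ·) (psi θ Ω Ωω n α) := by
      rw [← hc, ← veblen_gamma_zero]
      obtain ⟨d, hd⟩ := veblen_mem_range_opow (Γ_ c) 0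
      exact hd ▸ isPrincipal_add_omega0_opow d
    exact hp (ha.2 (le_self_add.trans_lt h)) (hb.2 (le_add_self.trans_lt h))
  · rw [phi_eq_veblen] at h
    rw [← hc] at ha hb ⊢
    exact (stronglyCritical_gamma c).2 a (ha.2 ((left_le_veblen a b).trans_lt h)) b
      (hb.2 ((right_le_veblen a b).trans_lt h))
  · rcases lt_trichotomy m n with hmn | rfl | hmn
    · exact (psi_lt_Omega hΩreg hΩ hθ m δ).trans (Omega_lt_psi_of_lt hΩreg hΩ hθ hmn α)
    · exact lt_psi_of_forall_le_mem hΩreg hΩ hθ fun y hy ↦ hy.eq_or_lt.elim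
        (fun h ↦ h ▸ psi_mem_Bset m hδ.1 hδα)
        (fun h ↦ Bset_mono hδα.le (mem_Bset_of_lt_psi h))
    · exact absurd h (Omega_lt_psi_of_lt hΩreg hΩ hθ hmn δ).not_gt

end Collapsing

/-- `B_n(α) ∩ Ω_n = ψ_n(α)`: identifying an ordinal with its set of predecessors,
an ordinal `β < Ω_n` belongs to `B_n(α)` if and only if `β < ψ_n(α)`. -/
theorem Bset_inter_Iio_Omega (θ : Ordinal) (Ω : ℕ → Ordinal) (Ωω : Ordinal)
    (hΩreg : ∀ n : ℕ, IsUncountableRegular (Ω n)) (hΩωreg : IsUncountableRegular Ωω)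
    (hΩmono : ∀ n : ℕ, Ω n < Ω (n + 1)) (hΩltω : ∀ n : ℕ, Ω n < Ωω)
    (hθ : θ < Ω 0)
    (n : ℕ) (α : Ordinal) :
    Bset θ Ω Ωω n α ∩ Set.Iio (Ω n) = Set.Iio (psi θ Ω Ωω n α) ∧
      ∀ β < Ω n, (β ∈ Bset θ Ω Ωω n α ↔ β < psi θ Ω Ωω n α) := by
  have hΩ : StrictMono Ω := strictMono_nat_of_lt_succ hΩmono
  refine ⟨Set.ext fun β ↦ ⟨fun h ↦ lt_psi_of_mem_Bset hΩreg hΩ hθ hΩltω h.1 h.2, fun h ↦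
    ⟨mem_Bset_of_lt_psi h, lt_trans h (psi_lt_Omega hΩreg hΩ hθ n α)⟩⟩, fun β hβ ↦
    ⟨fun h ↦ lt_psi_of_mem_Bset hΩreg hΩ hθ hΩltω h hβ, mem_Bset_of_lt_psi⟩⟩
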